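/- If Ω ⊂ ℝⁿ is bounded open with nonempty boundary, μ is a signed Radon measure on Ω with finite Morrey norm |||μ|||_{α,Ω} < ∞ for some 0 < α ≤ 1, and for k ≥ 1 one sets Ω_k = {x ∈ Ω : δ(x) > 1/k} and μ_k = 1_{Ω_k}·μ, then |||μ - μ_k|||_{α/2, Ω} ≤ |||μ|||_{α,Ω} · k^{-α/2}. -/

import Mathlib

open MeasureTheory Metric Set
open scoped ENNReal NNReal

/-- if `ν = |μ|` satisfies the Morrey bound with exponent `α` and constant
`M = |||μ|||_{α,Ω}`, and `Ω_k = {δ > 1/k}`, then `|μ - μ_k| = ν` restricted to `Ω \ Ω_k`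
satisfies `|||μ - μ_k|||_{α/2,Ω} ≤ M k^(-α/2)`. -/
theorem stmt5 (n : ℕ) (hn : 2 ≤ n) (Ω : Set (EuclideanSpace ℝ (Fin n)))
    (hΩo : IsOpen Ω) (hΩb : Bornology.IsBounded Ω) (hΩne : (frontier Ω).Nonempty)
    (ν : Measure (EuclideanSpace ℝ (Fin n))) (hνΩ : ν (Ωᶜ) = 0)
    (α : ℝ) (hα : 0 < α) (hα1 : α ≤ 1) (M : ℝ) (hM : 0 ≤ M)
    (hMor : ∀ x ∈ Ω, ∀ r : ℝ, 0 < r → r < Metric.infDist x (frontier Ω) / 2 →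
      ENNReal.ofReal (r ^ (2 - (n : ℝ) - α)) * ν (ball x r) ≤ ENNReal.ofReal M)
    (k : ℕ) (hk : 1 ≤ k) :
    ∀ x ∈ Ω, ∀ r : ℝ, 0 < r → r < Metric.infDist x (frontier Ω) / 2 →
      ENNReal.ofReal (r ^ (2 - (n : ℝ) - α / 2)) *
        ν (ball x r ∩ {y | Metric.infDist y (frontier Ω) ≤ 1 / (k : ℝ)}) ≤
        ENNReal.ofReal (M * (k : ℝ) ^ (-(α / 2))) := by
  intro x hx r hr hrx
  rcases (ball x r ∩ {y | Metric.infDist y (frontier Ω) ≤ 1 / (k : ℝ)}).eq_empty_or_nonempty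
    with h | ⟨y, hyx, hy⟩
  · rw [h, measure_empty, mul_zero]
    exact zero_le
  have hk0 : (0 : ℝ) < k := by exact_mod_cast hk
  have hrk : r ≤ (k : ℝ)⁻¹ := by
    have htri : infDist x (frontier Ω) ≤ infDist y (frontier Ω) + dist x y :=
      infDist_le_infDist_add_dist
    rw [mem_ball'] at hyx
    rw [mem_ofPred_eq, one_div] at hy
    linarith
  have hpow : r ^ (α / 2) ≤ (k : ℝ) ^ (-(α / 2)) := by
    rw [Real.rpow_neg hk0.le, ← Real.inv_rpow hk0.le]
    exact Real.rpow_le_rpow hr.le hrk (by positivity)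
  have hsplit : r ^ (2 - (n : ℝ) - α / 2) = r ^ (α / 2) * r ^ (2 - (n : ℝ) - α) := by
    rw [← Real.rpow_add hr]
    congr 1
    ring
  rw [hsplit, ENNReal.ofReal_mul (by positivity), mul_assoc, mul_comm M,
    ENNReal.ofReal_mul (by positivity)]
  gcongr
  exact le_trans (by gcongr; exact inter_subset_left) (hMor x hx r hr hrx)
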